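/- Let d ≥ 1 and let d_1 = lcm(1, 2, …, d). Let Λ(d,t) = {(λ_1,…,λ_d) ∈ ℤ_{≥0}^d : ∑_{j=1}^d j·λ_j = t}. If t ≥ (d-1)·d_1 − d(d+1)/2 + 1, then the coordinatewise addition map Λ(d,t) × Λ(d,d_1) → Λ(d, t + d_1) is surjective. -/

import Mathlib

theorem lambda_addition_surjective (d t : ℕ) (hd : 1 ≤ d)
    (d1 : ℕ) (hd1 : d1 = (Finset.Icc 1 d).lcm id)
    (ht : ((d : ℤ) - 1) * d1 - d * (d + 1) / 2 + 1 ≤ t) :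
    ∀ ρ : Fin d → ℕ, (∑ j : Fin d, ((j : ℕ) + 1) * ρ j) = t + d1 →
      ∃ lam lam' : Fin d → ℕ,
        (∑ j : Fin d, ((j : ℕ) + 1) * lam j) = t ∧
        (∑ j : Fin d, ((j : ℕ) + 1) * lam' j) = d1 ∧
        lam + lam' = ρ := by
  intro ρ hρ
  have hdvd : ∀ j : Fin d, ((j : ℕ) + 1) ∣ d1 := by
    intro j
    rw [hd1]
    exact Finset.dvd_lcm (f := id) (Finset.mem_Icc.mpr ⟨by omega, by omega⟩)
  by_cases h : ∃ j : Fin d, d1 ≤ ((j : ℕ) + 1) * ρ j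
  · obtain ⟨j, hj⟩ := h
    obtain ⟨c, hc⟩ := hdvd j
    have hcρ : c ≤ ρ j := by
      rw [hc] at hj
      exact Nat.le_of_mul_le_mul_left hj (Nat.succ_pos _)
    have hadd : (ρ - Pi.single j c) + Pi.single j c = ρ := by
      funext i
      by_cases hi : i = j
      · subst hi; simp; omega
      · simp [hi]
    have hs : (∑ i : Fin d, ((i : ℕ) + 1) * (Pi.single j c : Fin d → ℕ) i) = d1 := by
      rw [Finset.sum_eq_single j]
      · simp [hc]
      · intro b _ hb; simp [hb]
      · simp
    refine ⟨ρ - Pi.single j c, Pi.single j c, ?_, hs, hadd⟩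
    have h2 := hρ
    rw [← hadd] at h2
    simp only [Pi.add_apply, mul_add, Finset.sum_add_distrib] at h2
    omega
  · exfalso
    push Not at h
    have key : ∀ j : Fin d, ((j : ℕ) + 1) * ρ j + ((j : ℕ) + 1) ≤ d1 := by
      intro j
      obtain ⟨c, hc⟩ := hdvd j
      have h1 := h j
      rw [hc] at h1 ⊢
      have := Nat.lt_of_mul_lt_mul_left h1
      calc _ = ((j : ℕ) + 1) * (ρ j + 1) := by ring
        _ ≤ _ := Nat.mul_le_mul_left _ this
    have hsum := Finset.sum_le_sum (fun j (_ : j ∈ Finset.univ) => key j)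
    rw [Finset.sum_add_distrib, hρ] at hsum
    have hg : (∑ j : Fin d, ((j : ℕ) + 1)) * 2 = d * (d + 1) := by
      rw [Fin.sum_univ_eq_sum_range (fun i => i + 1) d]
      clear * -
      induction d with
      | zero => simp
      | succ n ih => rw [Finset.sum_range_succ, add_mul, ih]; ring
    simp only [Finset.sum_const, Finset.card_univ, Fintype.card_fin, smul_eq_mul] at hsum
    generalize (∑ j : Fin d, ((j : ℕ) + 1)) = S at *
    have hg' : (d : ℤ) * (d + 1) / 2 = S := by
      have : (d : ℤ) * (d + 1) = S * 2 := by exact_mod_cast hg.symm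
      rw [this]; simp
    rw [hg'] at ht
    zify at hsum
    linarith
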